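/- arXiv:2405.20543 — 3 statements merged into one kernel-verified Lean document; each statement's English description precedes it below -/
import Mathlib

section
/- Let G be a simple connected undirected graph on a finite vertex set V with |V| ≥ 2, and let P = (1/2)(I + A D⁻¹) be its lazy random walk matrix. Fix a vertex v ∈ V, a vector x ∈ ℝ^V with x(u) ≥ 0 for all u and x ≠ 0, a constant c > 1, and finite nonempty index sets I (aggregation filters) and J (comparison filters). Then for every ε > 0 there exists K ∈ ℕ such that: for all scale functions k : I → ℕ and a, b : J → ℕ with k(i) ≥ K, a(j) ≥ K, b(j) ≥ K for all i ∈ I, j ∈ J, and for all nonnegative score families s : I → ℝ and t : J → ℝ satisfying the c-band-dominance condition max_{j∈J} t(j) = c · max_{i∈I} s(i) together with max_{i∈I} s(i) > 0, it holds that Σ_{j∈J} t(j) · ((P^{a(j)} − P^{b(j)}) x)(v) ≤ ε · c · Σ_{i∈I} s(i) · (P^{k(i)} x)(v). -/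
open Matrix BigOperators

/-- The lazy random walk matrix `P = (1/2)(I + A D⁻¹)` of a simple graph. -/
noncomputable def lazyWalk {V : Type*} [Fintype V] [DecidableEq V]
    (G : SimpleGraph V) [DecidableRel G.Adj] : Matrix V V ℝ :=
  (1 / 2 : ℝ) • (1 + G.adjMatrix ℝ * Matrix.diagonal (fun u => ((G.degree u : ℝ))⁻¹))

open Filter Topology

section RowStochastic

variable {V : Type*} [Fintype V] [DecidableEq V]

/-- A row stochastic matrix does not increase upper bounds of a vector. -/
theorem mulVec_apply_le_of_mem_rowStochastic {Q : Matrix V V ℝ} (hQ : Q ∈ rowStochastic ℝ V)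
    {y : V → ℝ} {B : ℝ} (hB : ∀ w, y w ≤ B) (u : V) : (Q *ᵥ y) u ≤ B :=
  calc (Q *ᵥ y) u ≤ ∑ w, Q u w * B := Finset.sum_le_sum fun w _ =>
        mul_le_mul_of_nonneg_left (hB w) (nonneg_of_mem_rowStochastic hQ)
    _ = B := by rw [← Finset.sum_mul, sum_row_of_mem_rowStochastic hQ, one_mul]

/-- A row stochastic matrix does not decrease lower bounds of a vector. -/
theorem le_mulVec_apply_of_mem_rowStochastic {Q : Matrix V V ℝ} (hQ : Q ∈ rowStochastic ℝ V)
    {y : V → ℝ} {B : ℝ} (hB : ∀ w, B ≤ y w) (u : V) : B ≤ (Q *ᵥ y) u :=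
  calc B = ∑ w, Q u w * B := by rw [← Finset.sum_mul, sum_row_of_mem_rowStochastic hQ, one_mul]
    _ ≤ (Q *ᵥ y) u := Finset.sum_le_sum fun w _ =>
        mul_le_mul_of_nonneg_left (hB w) (nonneg_of_mem_rowStochastic hQ)

/-- Doeblin's estimate: a row stochastic matrix with entries at least `δ` moves every entry of
a vector away from an upper bound by at least `δ` times the gap at any coordinate. -/
theorem mulVec_apply_le_sub_of_le {Q : Matrix V V ℝ} (hQ : Q ∈ rowStochastic ℝ V) {δ : ℝ}
    (hδ : ∀ u w, δ ≤ Q u w) {y : V → ℝ} {B : ℝ} (hB : ∀ w, y w ≤ B) (u w : V) :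
    (Q *ᵥ y) u ≤ B - δ * (B - y w) := by
  have hsum : B - (Q *ᵥ y) u = ∑ w, Q u w * (B - y w) := by
    simp only [mul_sub, Finset.sum_sub_distrib, ← Finset.sum_mul,
      sum_row_of_mem_rowStochastic hQ, one_mul]
    rfl
  have hsingle : Q u w * (B - y w) ≤ ∑ w, Q u w * (B - y w) :=
    Finset.single_le_sum (f := fun w => Q u w * (B - y w)) (fun w _ =>
      mul_nonneg (nonneg_of_mem_rowStochastic hQ) (sub_nonneg.2 (hB w))) (Finset.mem_univ w)
  have := mul_le_mul_of_nonneg_right (hδ u w) (sub_nonneg.2 (hB w))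
  linarith

/-- The powers of a row stochastic matrix, one of which is entrywise positive, send a nonzero
nonnegative vector to a positive constant in the limit. -/
theorem exists_pos_tendsto_pow_mulVec_apply [Nonempty V] {Q : Matrix V V ℝ}
    (hQ : Q ∈ rowStochastic ℝ V) {N : ℕ} (hN : ∀ u w, 0 < (Q ^ N) u w) {y : V → ℝ}
    (hy : ∀ u, 0 ≤ y u) (hy0 : y ≠ 0) :
    ∃ L : ℝ, 0 < L ∧ ∀ u, Tendsto (fun k => (Q ^ k *ᵥ y) u) atTop (𝓝 L) := by
  have hpow : ∀ k, Q ^ k ∈ rowStochastic ℝ V := fun k => pow_mem hQ k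
  set f : ℕ → V → ℝ := fun k => Q ^ k *ᵥ y with hf
  have hadd : ∀ n k, f (k + n) = Q ^ n *ᵥ f k := fun n k => by
    simp only [hf, Matrix.mulVec_mulVec, ← pow_add, add_comm]
  have hleM : ∀ k u, f k u ≤ ⨆ w, f k w := fun k u => le_ciSup (Set.finite_range _).bddAbove u
  have hmle : ∀ k u, ⨅ w, f k w ≤ f k u := fun k u => ciInf_le (Set.finite_range _).bddBelow u
  have hanti : Antitone fun k => ⨆ w, f k w := antitone_nat_of_succ_le fun k =>
    ciSup_le fun u => by
      rw [hadd]; exact mulVec_apply_le_of_mem_rowStochastic (hpow 1) (hleM k) u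
  have hmono : Monotone fun k => ⨅ w, f k w := monotone_nat_of_le_succ fun k =>
    le_ciInf fun u => by
      rw [hadd]; exact le_mulVec_apply_of_mem_rowStochastic (hpow 1) (hmle k) u
  obtain ⟨u₀⟩ := ‹Nonempty V›
  have hM := tendsto_atTop_ciInf hanti ⟨⨅ w, f 0 w, by
    rintro _ ⟨k, rfl⟩
    exact (hmono (Nat.zero_le k)).trans ((hmle k u₀).trans (hleM k u₀))⟩
  have hm := tendsto_atTop_ciSup hmono ⟨⨆ w, f 0 w, by
    rintro _ ⟨k, rfl⟩
    exact ((hmle k u₀).trans (hleM k u₀)).trans (hanti (Nat.zero_le k))⟩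
  set L := ⨅ k, ⨆ w, f k w
  set L' := ⨆ k, ⨅ w, f k w
  have hL'L : L' ≤ L := le_of_tendsto_of_tendsto' hm hM fun k => (hmle k u₀).trans (hleM k u₀)
  obtain ⟨p, hp⟩ := Finite.exists_min fun p : V × V => (Q ^ N) p.1 p.2
  set δ := (Q ^ N) p.1 p.2
  have hδ : 0 < δ := hN _ _
  have hstep : ∀ k, ⨆ w, f (k + N) w ≤ (⨆ w, f k w) - δ * ((⨆ w, f k w) - ⨅ w, f k w) :=
    fun k => ciSup_le fun u => by
      obtain ⟨w, hw⟩ := exists_eq_ciInf_of_finite (f := f k)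
      rw [hadd, ← hw]
      exact mulVec_apply_le_sub_of_le (hpow N) (fun u w => hp (u, w)) (hleM k) u w
  have hLL' : L ≤ L' := by
    have := le_of_tendsto_of_tendsto' (hM.comp (tendsto_add_atTop_nat N))
      (hM.sub ((hM.sub hm).const_mul δ)) hstep
    nlinarith
  have hposN : 0 < ⨅ w, f N w := by
    obtain ⟨w, hw⟩ := exists_eq_ciInf_of_finite (f := f N)
    obtain ⟨z, hz⟩ := Function.ne_iff.1 hy0
    rw [← hw]
    exact Finset.sum_pos' (fun u _ => mul_nonneg (hN w u).le (hy u))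
      ⟨z, Finset.mem_univ z, mul_pos (hN w z) ((hy z).lt_of_ne' hz)⟩
  refine ⟨L, hposN.trans_le ((hmono.ge_of_tendsto hm N).trans hL'L), fun u => ?_⟩
  exact tendsto_of_tendsto_of_tendsto_of_le_of_le (hLL'.antisymm hL'L ▸ hm) hM
    (fun k => hmle k u) (fun k => hleM k u)

end RowStochastic

section LazyWalk

variable {V : Type*} [Fintype V] [DecidableEq V] (G : SimpleGraph V) [DecidableRel G.Adj]

theorem lazyWalk_apply (u w : V) :
    lazyWalk G u w =
      1 / 2 * ((if u = w then 1 else 0) + (if G.Adj u w then 1 else 0) * (G.degree w : ℝ)⁻¹) := by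
  simp [lazyWalk, Matrix.one_apply, SimpleGraph.adjMatrix_apply]

theorem lazyWalk_nonneg (u w : V) : 0 ≤ lazyWalk G u w := by
  rw [lazyWalk_apply]
  positivity

theorem lazyWalk_self_pos (u : V) : 0 < lazyWalk G u u := by
  simp [lazyWalk_apply]

theorem lazyWalk_pos_of_adj {u w : V} (h : G.Adj u w) : 0 < lazyWalk G u w := by
  have : 0 < G.degree w := (G.degree_pos_iff_exists_adj w).2 ⟨u, h.symm⟩
  rw [lazyWalk_apply, if_neg h.ne, if_pos h]
  positivity

theorem transpose_lazyWalk_mem_rowStochastic (hdeg : ∀ u, 0 < G.degree u) :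
    (lazyWalk G)ᵀ ∈ rowStochastic ℝ V := by
  rw [mem_rowStochastic_iff_sum]
  refine ⟨fun u w => lazyWalk_nonneg G w u, fun u => ?_⟩
  have hu : (G.degree u : ℝ) ≠ 0 := by exact_mod_cast (hdeg u).ne'
  have hsum : ∑ w, (if G.Adj w u then (1 : ℝ) else 0) = G.degree u := by
    simp [G.adj_comm _ u, ← G.card_neighborFinset_eq_degree, G.neighborFinset_eq_filter]
  simp only [Matrix.transpose_apply, lazyWalk_apply, ← Finset.mul_sum, Finset.sum_add_distrib,
    ← Finset.sum_mul, hsum, mul_inv_cancel₀ hu]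
  norm_num

/-- Detailed balance: the degree vector symmetrizes the lazy random walk matrix. -/
theorem lazyWalk_mul_diagonal_degree (hdeg : ∀ u, 0 < G.degree u) :
    lazyWalk G * Matrix.diagonal (fun u => (G.degree u : ℝ)) =
      Matrix.diagonal (fun u => (G.degree u : ℝ)) * (lazyWalk G)ᵀ := by
  ext u w
  have hu : (G.degree u : ℝ) ≠ 0 := by exact_mod_cast (hdeg u).ne'
  have hw : (G.degree w : ℝ) ≠ 0 := by exact_mod_cast (hdeg w).ne'
  rw [Matrix.mul_diagonal, Matrix.diagonal_mul, Matrix.transpose_apply, lazyWalk_apply,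
    lazyWalk_apply]
  by_cases h : u = w
  · subst h
    ring
  · simp only [if_neg h, if_neg (Ne.symm h), G.adj_comm w u]
    field_simp
    ring

theorem pow_apply_pos_of_le {Q : Matrix V V ℝ} (hQ : ∀ u w, 0 ≤ Q u w) (hdiag : ∀ u, 0 < Q u u)
    {u w : V} {m n : ℕ} (hmn : m ≤ n) (h : 0 < (Q ^ m) u w) : 0 < (Q ^ n) u w := by
  induction n, hmn using Nat.le_induction with
  | base => exact h
  | succ n _ ih =>
    rw [pow_succ, Matrix.mul_apply]
    exact Finset.sum_pos' (fun z _ => mul_nonneg (Matrix.pow_apply_nonneg hQ n u z) (hQ z w))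
      ⟨w, Finset.mem_univ w, mul_pos ih (hdiag w)⟩

theorem lazyWalk_pow_length_pos {u w : V} (p : G.Walk u w) : 0 < (lazyWalk G ^ p.length) u w := by
  induction p with
  | nil => simp
  | @cons u z w h p ih =>
    rw [SimpleGraph.Walk.length_cons, pow_succ', Matrix.mul_apply]
    exact Finset.sum_pos' (fun y _ => mul_nonneg (lazyWalk_nonneg G u y)
        (Matrix.pow_apply_nonneg (lazyWalk_nonneg G) p.length y w))
      ⟨z, Finset.mem_univ z, mul_pos (lazyWalk_pos_of_adj G h) ih⟩

theorem exists_lazyWalk_pow_pos (hconn : G.Connected) : ∃ N, ∀ u w, 0 < (lazyWalk G ^ N) u w := by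
  choose n hn using fun p : V × V =>
    (⟨_, lazyWalk_pow_length_pos G (hconn.preconnected p.1 p.2).some⟩ :
      ∃ n, 0 < (lazyWalk G ^ n) p.1 p.2)
  exact ⟨Finset.univ.sup n, fun u w => pow_apply_pos_of_le (lazyWalk_nonneg G)
    (lazyWalk_self_pos G) (Finset.le_sup (Finset.mem_univ (u, w))) (hn (u, w))⟩

/-- On a connected graph, the lazy random walk started from a nonzero nonnegative vector has a
positive limit at every vertex. -/
theorem exists_pos_tendsto_lazyWalk_pow_mulVec (hconn : G.Connected) (hcard : 2 ≤ Fintype.card V)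
    (v : V) (x : V → ℝ) (hx : ∀ u, 0 ≤ x u) (hx0 : x ≠ 0) :
    ∃ F : ℝ, 0 < F ∧ Tendsto (fun k => (lazyWalk G ^ k *ᵥ x) v) atTop (𝓝 F) := by
  have : Nontrivial V := Fintype.one_lt_card_iff_nontrivial.1 hcard
  have hdeg : ∀ u, 0 < G.degree u := fun u => hconn.preconnected.degree_pos_of_nontrivial u
  have hdeg' : ∀ u, (0 : ℝ) < G.degree u := fun u => by exact_mod_cast hdeg u
  obtain ⟨N, hN⟩ := exists_lazyWalk_pow_pos G hconn
  set y : V → ℝ := fun u => x u / G.degree u with hy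
  have hxy : x = Matrix.diagonal (fun u => (G.degree u : ℝ)) *ᵥ y := by
    ext u
    rw [Matrix.mulVec_diagonal, mul_div_cancel₀ _ (hdeg' u).ne']
  obtain ⟨L, hL, hlim⟩ := exists_pos_tendsto_pow_mulVec_apply
    (transpose_lazyWalk_mem_rowStochastic G hdeg) (N := N)
    (fun u w => by rw [← Matrix.transpose_pow]; exact hN w u)
    (y := y) (fun u => div_nonneg (hx u) (hdeg' u).le)
    (fun h => hx0 (by rw [hxy, h, Matrix.mulVec_zero]))
  refine ⟨G.degree v * L, mul_pos (hdeg' v) hL, ((hlim v).const_mul _).congr fun k => ?_⟩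
  have hsemi : SemiconjBy (Matrix.diagonal fun u => (G.degree u : ℝ)) (lazyWalk G)ᵀ (lazyWalk G) :=
    (lazyWalk_mul_diagonal_degree G hdeg).symm
  rw [hxy, Matrix.mulVec_mulVec, ← (hsemi.pow_right k).eq, ← Matrix.mulVec_mulVec,
    Matrix.mulVec_diagonal]

end LazyWalk

/-- In the non-decoupled architecture, for any `c`-band-dominant representation at a node `v`
of a nonnegative nonzero signal `x`, if the scales of all filters are sufficiently large, the
attention-weighted band-pass (comparison) responses are dominated by `ε·c` times the
attention-weighted low-pass (aggregation) responses. -/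
theorem band_dominance_theorem {V : Type*} [Fintype V] [DecidableEq V]
    (G : SimpleGraph V) [DecidableRel G.Adj]
    (hconn : G.Connected) (hcard : 2 ≤ Fintype.card V)
    (v : V) (x : V → ℝ) (hx : ∀ u : V, 0 ≤ x u) (hx0 : x ≠ 0)
    (c : ℝ) (hc : 1 < c)
    {I J : Type*} [Fintype I] [Fintype J] [Nonempty I] [Nonempty J]
    (ε : ℝ) (hε : 0 < ε) :
    ∃ K : ℕ, ∀ (k : I → ℕ) (a b : J → ℕ),
      (∀ i : I, K ≤ k i) → (∀ j : J, K ≤ a j) → (∀ j : J, K ≤ b j) →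
      ∀ (s : I → ℝ) (t : J → ℝ), (∀ i : I, 0 ≤ s i) → (∀ j : J, 0 ≤ t j) →
        (Finset.univ.sup' Finset.univ_nonempty t
          = c * Finset.univ.sup' Finset.univ_nonempty s) →
        0 < Finset.univ.sup' Finset.univ_nonempty s →
        ∑ j : J, t j * ((lazyWalk G ^ a j - lazyWalk G ^ b j).mulVec x v) ≤
          ε * c * ∑ i : I, s i * ((lazyWalk G ^ k i).mulVec x v) := by
  obtain ⟨F, hF, hlim⟩ := exists_pos_tendsto_lazyWalk_pow_mulVec G hconn hcard v x hx hx0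
  have hJ : (0 : ℝ) < Fintype.card J := by exact_mod_cast Fintype.card_pos
  set η : ℝ := min (F / 2) (ε * F / (4 * Fintype.card J)) with hη
  have hη0 : 0 < η := by positivity
  obtain ⟨K, hK⟩ := Metric.tendsto_atTop.1 hlim η hη0
  refine ⟨K, fun k a b hk ha hb s t hs ht hst hpos => ?_⟩
  obtain ⟨i₀, -, hi₀⟩ := Finset.exists_mem_eq_sup' Finset.univ_nonempty s
  rw [hi₀] at hst hpos
  have hnear : ∀ n, K ≤ n → |(lazyWalk G ^ n *ᵥ x) v - F| < η := fun n hn => hK n hn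
  have hlow : ∀ n, K ≤ n → F / 2 ≤ (lazyWalk G ^ n *ᵥ x) v := fun n hn => by
    have := (abs_lt.1 (hnear n hn)).1
    have : η ≤ F / 2 := min_le_left _ _
    linarith
  have hdiff : ∀ j, ((lazyWalk G ^ a j - lazyWalk G ^ b j) *ᵥ x) v ≤ 2 * η := fun j => by
    rw [Matrix.sub_mulVec, Pi.sub_apply]
    have := (abs_lt.1 (hnear _ (ha j))).2
    have := (abs_lt.1 (hnear _ (hb j))).1
    linarith
  have htle : ∀ j, t j ≤ c * s i₀ := fun j => hst ▸ Finset.le_sup' t (Finset.mem_univ j)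
  have hcs : 0 < c * s i₀ := by positivity
  calc ∑ j : J, t j * ((lazyWalk G ^ a j - lazyWalk G ^ b j).mulVec x v)
      ≤ ∑ _j : J, c * s i₀ * (2 * η) := Finset.sum_le_sum fun j _ =>
        (mul_le_mul_of_nonneg_left (hdiff j) (ht j)).trans
          (mul_le_mul_of_nonneg_right (htle j) (by positivity))
    _ = c * s i₀ * (2 * Fintype.card J * η) := by
        rw [Finset.sum_const, Finset.card_univ, nsmul_eq_mul]; ring
    _ ≤ c * s i₀ * (2 * Fintype.card J * (ε * F / (4 * Fintype.card J))) := by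
        gcongr
        exact min_le_right _ _
    _ = ε * c * (s i₀ * (F / 2)) := by field_simp; ring
    _ ≤ ε * c * ∑ i : I, s i * ((lazyWalk G ^ k i).mulVec x v) := by
        gcongr
        calc s i₀ * (F / 2) ≤ s i₀ * ((lazyWalk G ^ k i₀).mulVec x v) := by
              gcongr
              exact hlow _ (hk i₀)
          _ ≤ _ := Finset.single_le_sum
              (f := fun i => s i * ((lazyWalk G ^ k i).mulVec x v))
              (fun i _ => mul_nonneg (hs i) (by linarith [hlow _ (hk i)])) (Finset.mem_univ i₀)
end

section
/- Let G be a simple connected undirected graph on a finite vertex set V with |V| ≥ 2, and let P = (1/2)(I + A D⁻¹) be its lazy random walk matrix. Then for every vector x ∈ ℝ^V with x(u) ≥ 0 for all u ∈ V, the sequence of vectors k ↦ P^k x converges (entrywise, as k → ∞) to the vector ((Σ_{u∈V} x(u)) / (Σ_{u∈V} d(u))) • d, where d is the degree vector of G. -/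
open Matrix BigOperators Filter

section LazyWalk

variable {V : Type*} [Fintype V] (G : SimpleGraph V) [DecidableRel G.Adj]

/-- The squared norm `∑ z(u)² / deg(u)`, with respect to which `A D⁻¹` is a contraction. -/
noncomputable def walkEnergy (z : V → ℝ) : ℝ :=
  ∑ u, z u ^ 2 / (G.degree u : ℝ)

lemma walkEnergy_nonneg (z : V → ℝ) : 0 ≤ walkEnergy G z :=
  Finset.sum_nonneg fun _ _ => by positivity

lemma sum_sum_neighborFinset (f : V → ℝ) :
    ∑ u, ∑ v ∈ G.neighborFinset u, f v = ∑ v, (G.degree v : ℝ) * f v := by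
  rw [Finset.sum_comm' (t' := Finset.univ) (s' := fun v => G.neighborFinset v)
    (by simp [SimpleGraph.adj_comm])]
  simp

lemma sum_degree_pos [Nonempty V] (hpos : ∀ u, 0 < G.degree u) :
    0 < ∑ u, (G.degree u : ℝ) :=
  Finset.sum_pos (fun u _ => by exact_mod_cast hpos u) Finset.univ_nonempty

variable [DecidableEq V]

/-- The (non-lazy) random walk matrix `A D⁻¹` of a simple graph. -/
noncomputable def simpleWalk : Matrix V V ℝ :=
  G.adjMatrix ℝ * Matrix.diagonal (fun u => ((G.degree u : ℝ))⁻¹)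

lemma simpleWalk_mulVec_apply (z : V → ℝ) (u : V) :
    (simpleWalk G *ᵥ z) u = ∑ v ∈ G.neighborFinset u, z v / (G.degree v : ℝ) := by
  rw [simpleWalk, ← Matrix.mulVec_mulVec, SimpleGraph.adjMatrix_mulVec_apply]
  refine Finset.sum_congr rfl fun v _ => ?_
  rw [Matrix.mulVec_diagonal, div_eq_inv_mul]

lemma lazyWalk_mulVec_apply (z : V → ℝ) (u : V) :
    (lazyWalk G *ᵥ z) u = (z u + (simpleWalk G *ᵥ z) u) / 2 := by
  have h : lazyWalk G = (1 / 2 : ℝ) • (1 + simpleWalk G) := rfl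
  rw [h, Matrix.smul_mulVec, Matrix.add_mulVec, Matrix.one_mulVec]
  simp only [Pi.smul_apply, Pi.add_apply, smul_eq_mul]
  ring

lemma sum_simpleWalk_mulVec (hpos : ∀ u, 0 < G.degree u) (z : V → ℝ) :
    ∑ u, (simpleWalk G *ᵥ z) u = ∑ u, z u := by
  simp only [simpleWalk_mulVec_apply]
  rw [sum_sum_neighborFinset]
  refine Finset.sum_congr rfl fun v _ => ?_
  have : (G.degree v : ℝ) ≠ 0 := by exact_mod_cast (hpos v).ne'
  field_simp

lemma sum_lazyWalk_pow_mulVec (hpos : ∀ u, 0 < G.degree u) (x : V → ℝ) (k : ℕ) :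
    ∑ u, (lazyWalk G ^ k *ᵥ x) u = ∑ u, x u := by
  induction k with
  | zero => simp
  | succ k ih =>
    rw [pow_succ', ← Matrix.mulVec_mulVec]
    simp only [lazyWalk_mulVec_apply]
    rw [← Finset.sum_div, Finset.sum_add_distrib, sum_simpleWalk_mulVec G hpos, ih]
    ring

lemma walkEnergy_simpleWalk_le (z : V → ℝ) :
    walkEnergy G (simpleWalk G *ᵥ z) ≤ walkEnergy G z := by
  have key : ∀ u, (simpleWalk G *ᵥ z) u ^ 2 / (G.degree u : ℝ) ≤
      ∑ v ∈ G.neighborFinset u, (z v / (G.degree v : ℝ)) ^ 2 := fun u => by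
    rw [simpleWalk_mulVec_apply]
    refine div_le_of_le_mul₀ (by positivity) (Finset.sum_nonneg fun _ _ => sq_nonneg _) ?_
    rw [mul_comm, ← G.card_neighborFinset_eq_degree]
    exact sq_sum_le_card_mul_sum_sq
  refine (Finset.sum_le_sum fun u _ => key u).trans (le_of_eq ?_)
  rw [sum_sum_neighborFinset]
  refine Finset.sum_congr rfl fun v _ => ?_
  by_cases h : (G.degree v : ℝ) = 0
  · simp [h]
  · field_simp

lemma walkEnergy_sub_simpleWalk_le (z : V → ℝ) :
    walkEnergy G (z - simpleWalk G *ᵥ z) ≤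
      4 * (walkEnergy G z - walkEnergy G (lazyWalk G *ᵥ z)) := by
  have parallelogram : walkEnergy G (z - simpleWalk G *ᵥ z) + 4 * walkEnergy G (lazyWalk G *ᵥ z) =
      2 * walkEnergy G z + 2 * walkEnergy G (simpleWalk G *ᵥ z) := by
    simp only [walkEnergy, lazyWalk_mulVec_apply, Pi.sub_apply, Finset.mul_sum,
      ← Finset.sum_add_distrib]
    exact Finset.sum_congr rfl fun u _ => by ring
  linarith [walkEnergy_simpleWalk_le G z]

lemma tendsto_sub_simpleWalk (hpos : ∀ u, 0 < G.degree u) (x : V → ℝ) :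
    Tendsto (fun k : ℕ => lazyWalk G ^ k *ᵥ x - simpleWalk G *ᵥ (lazyWalk G ^ k *ᵥ x))
      atTop (nhds 0) := by
  set e : ℕ → ℝ := fun k => walkEnergy G (lazyWalk G ^ k *ᵥ x) with he
  have step : ∀ k, walkEnergy G (lazyWalk G ^ k *ᵥ x - simpleWalk G *ᵥ (lazyWalk G ^ k *ᵥ x)) ≤
      4 * (e k - e (k + 1)) := fun k => by
    simpa only [he, pow_succ', ← Matrix.mulVec_mulVec] using
      walkEnergy_sub_simpleWalk_le G (lazyWalk G ^ k *ᵥ x)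
  have anti : Antitone e := antitone_nat_of_succ_le fun k => by
    linarith [step k, walkEnergy_nonneg G
      (lazyWalk G ^ k *ᵥ x - simpleWalk G *ᵥ (lazyWalk G ^ k *ᵥ x))]
  have lim := tendsto_atTop_ciInf anti ⟨0, by rintro _ ⟨k, rfl⟩; exact walkEnergy_nonneg G _⟩
  have diff : Tendsto (fun k => e k - e (k + 1)) atTop (nhds 0) := by
    simpa using lim.sub (lim.comp (tendsto_add_atTop_nat 1))
  rw [tendsto_pi_nhds]
  intro u
  have hu : (0 : ℝ) < G.degree u := by exact_mod_cast hpos u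
  have bound : Tendsto (fun k => √((G.degree u : ℝ) * (4 * (e k - e (k + 1))))) atTop
      (nhds 0) := by
    simpa using ((diff.const_mul 4).const_mul (G.degree u : ℝ)).sqrt
  refine squeeze_zero_norm (fun k => Real.abs_le_sqrt ?_) bound
  rw [← div_le_iff₀' hu]
  refine le_trans ?_ (step k)
  exact Finset.single_le_sum (f := fun v =>
    (lazyWalk G ^ k *ᵥ x - simpleWalk G *ᵥ (lazyWalk G ^ k *ᵥ x)) v ^ 2 / (G.degree v : ℝ))
    (fun _ _ => by positivity) (Finset.mem_univ u)

lemma simpleWalk_mulVec_degree (hpos : ∀ u, 0 < G.degree u) (c : ℝ) :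
    simpleWalk G *ᵥ (c • fun u => (G.degree u : ℝ)) = c • fun u => (G.degree u : ℝ) := by
  ext u
  rw [simpleWalk_mulVec_apply, Finset.sum_congr rfl (g := fun _ => c) fun v _ => ?_]
  · simp [mul_comm]
  · have : (G.degree v : ℝ) ≠ 0 := by exact_mod_cast (hpos v).ne'
    simp [this]

lemma eq_smul_degree_of_simpleWalk_mulVec_eq (hconn : G.Connected) (hpos : ∀ u, 0 < G.degree u)
    {z : V → ℝ} (hz : simpleWalk G *ᵥ z = z) :
    ∃ c : ℝ, z = c • fun u => (G.degree u : ℝ) := by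
  have hne : ∀ u, (G.degree u : ℝ) ≠ 0 := fun u => by exact_mod_cast (hpos u).ne'
  have hlap : G.lapMatrix ℝ *ᵥ (fun u => z u / (G.degree u : ℝ)) = 0 := by
    ext u
    rw [SimpleGraph.lapMatrix_mulVec_apply, ← simpleWalk_mulVec_apply, hz,
      mul_div_cancel₀ _ (hne u), sub_self, Pi.zero_apply]
  rw [SimpleGraph.lapMatrix_mulVec_eq_zero_iff_forall_reachable] at hlap
  obtain ⟨w⟩ := hconn.nonempty
  refine ⟨z w / (G.degree w : ℝ), funext fun u => ?_⟩
  rw [Pi.smul_apply, smul_eq_mul, ← hlap u w (hconn.preconnected u w), div_mul_cancel₀ _ (hne u)]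

/-- The linear map `z ↦ (z - A D⁻¹ z, ∑ z(u))`. -/
noncomputable def walkDefect : (V → ℝ) →ₗ[ℝ] (V → ℝ) × ℝ :=
  (LinearMap.id - (simpleWalk G).mulVecLin).prod (∑ u, LinearMap.proj u)

lemma walkDefect_apply (z : V → ℝ) :
    walkDefect G z = (z - simpleWalk G *ᵥ z, ∑ u, z u) := by
  simp [walkDefect]

lemma ker_walkDefect (hconn : G.Connected) (hpos : ∀ u, 0 < G.degree u) :
    LinearMap.ker (walkDefect G) = ⊥ := by
  rw [LinearMap.ker_eq_bot']
  intro z hz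
  rw [walkDefect_apply, Prod.mk_eq_zero, sub_eq_zero] at hz
  obtain ⟨c, rfl⟩ := eq_smul_degree_of_simpleWalk_mulVec_eq G hconn hpos hz.1.symm
  have := hconn.nonempty
  have hsum := hz.2
  simp only [Pi.smul_apply, smul_eq_mul, ← Finset.mul_sum] at hsum
  rw [(mul_eq_zero.mp hsum).resolve_right (sum_degree_pos G hpos).ne', zero_smul]

end LazyWalk


/-- For a connected simple graph on at least two vertices and any entrywise nonnegative
vector `x`, the iterates `P^k x` of the lazy random walk converge to the suitably scaled
degree vector `(‖x‖₁ / ‖d‖₁) • d`. -/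
theorem lazyWalk_iterates_tendsto_degree {V : Type*} [Fintype V] [DecidableEq V]
    (G : SimpleGraph V) [DecidableRel G.Adj]
    (hconn : G.Connected) (hcard : 2 ≤ Fintype.card V)
    (d : V → ℝ) (hd : d = fun u => (G.degree u : ℝ))
    (x : V → ℝ) (hx : ∀ u : V, 0 ≤ x u) :
    Tendsto (fun k : ℕ => (lazyWalk G ^ k).mulVec x) atTop
      (nhds (((∑ u : V, x u) / ∑ u : V, d u) • d)) := by
  have hnt : Nontrivial V := Fintype.one_lt_card_iff_nontrivial.mp hcard
  have hpos : ∀ u, 0 < G.degree u := fun u => hconn.preconnected.degree_pos_of_nontrivial u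
  subst hd
  set c : ℝ := (∑ u, x u) / ∑ u, (G.degree u : ℝ)
  obtain ⟨g, hg⟩ := (walkDefect G).exists_leftInverse_of_injective (ker_walkDefect G hconn hpos)
  have hg' : ∀ z, g (walkDefect G z) = z := fun z => LinearMap.congr_fun hg z
  have hlim : walkDefect G (c • fun u => (G.degree u : ℝ)) = (0, ∑ u, x u) := by
    rw [walkDefect_apply, simpleWalk_mulVec_degree G hpos, sub_self]
    simp only [Pi.smul_apply, smul_eq_mul, ← Finset.mul_sum]
    rw [div_mul_cancel₀ _ (sum_degree_pos G hpos).ne']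
  have hdefect : Tendsto (fun k : ℕ => walkDefect G (lazyWalk G ^ k *ᵥ x)) atTop
      (nhds (walkDefect G (c • fun u => (G.degree u : ℝ)))) := by
    simp only [hlim, walkDefect_apply, sum_lazyWalk_pow_mulVec G hpos]
    exact (tendsto_sub_simpleWalk G hpos x).prodMk_nhds tendsto_const_nhds
  simpa only [Function.comp_def, hg'] using
    (g.continuous_of_finiteDimensional.tendsto _).comp hdefect
end

section
/- Let I, J be finite nonempty index sets, let s : J → ℝ and t : I → ℝ be nonnegative families of scores, let h : J → ℝ and g : I → ℝ be families of real numbers, and let c > 1, ε > 0 and 0 < δ < p∞ be real numbers. Suppose that (i) |h(j)| ≤ δ for all j ∈ J, (ii) |g(i) − p∞| ≤ δ for all i ∈ I, (iii) max_{j∈J} s(j) = c · max_{i∈I} t(i), and (iv) |J| · δ ≤ ε · (p∞ − δ). Then Σ_{j∈J} s(j)·h(j) ≤ ε · c · Σ_{i∈I} t(i)·g(i). -/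
open BigOperators

/-- Key quantitative step in the band-dominance theorem: if the band-pass responses `h` are
`δ`-small, the low-pass responses `g` are `δ`-close to `p∞`, the scores satisfy the
`c`-band-dominance condition `max s = c · max t`, and `|J| · δ ≤ ε · (p∞ − δ)`, then the
weighted band-pass responses are bounded by `ε · c` times the weighted low-pass responses. -/
theorem band_dominance_key_step {I J : Type*} [Fintype I] [Fintype J] [Nonempty I] [Nonempty J]
    (s : J → ℝ) (t : I → ℝ) (h : J → ℝ) (g : I → ℝ)
    (c ε δ pinf : ℝ)
    (hs : ∀ j : J, 0 ≤ s j) (ht : ∀ i : I, 0 ≤ t i)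
    (hc : 1 < c) (hε : 0 < ε) (hδ0 : 0 < δ) (hδp : δ < pinf)
    (hh : ∀ j : J, |h j| ≤ δ) (hg : ∀ i : I, |g i - pinf| ≤ δ)
    (hdom : Finset.univ.sup' Finset.univ_nonempty s
      = c * Finset.univ.sup' Finset.univ_nonempty t)
    (hcard : (Fintype.card J : ℝ) * δ ≤ ε * (pinf - δ)) :
    ∑ j : J, s j * h j ≤ ε * c * ∑ i : I, t i * g i := by
  obtain ⟨i₀, -, hi₀⟩ := Finset.exists_mem_eq_sup' (Finset.univ_nonempty (α := I)) t
  rw [hi₀] at hdom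
  have hg_lower (i : I) : pinf - δ ≤ g i := by linarith [(abs_le.mp (hg i)).1]
  have hs_le (j : J) : s j ≤ c * t i₀ := hdom ▸ Finset.le_sup' s (Finset.mem_univ j)
  have hct : 0 ≤ c * t i₀ := mul_nonneg (by linarith) (ht i₀)
  calc ∑ j : J, s j * h j
      ≤ ∑ _j : J, c * t i₀ * δ := Finset.sum_le_sum fun j _ =>
        (mul_le_mul_of_nonneg_left ((le_abs_self _).trans (hh j)) (hs j)).trans
          (mul_le_mul_of_nonneg_right (hs_le j) hδ0.le)
    _ = c * t i₀ * (Fintype.card J * δ) := by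
        rw [Finset.sum_const, Finset.card_univ, nsmul_eq_mul]
        ring
    _ ≤ c * t i₀ * (ε * (pinf - δ)) := mul_le_mul_of_nonneg_left hcard hct
    _ = ε * c * (t i₀ * (pinf - δ)) := by ring
    _ ≤ ε * c * ∑ i : I, t i * g i := by
        refine mul_le_mul_of_nonneg_left ?_ (mul_nonneg hε.le (by linarith))
        exact (mul_le_mul_of_nonneg_left (hg_lower i₀) (ht i₀)).trans <|
          Finset.single_le_sum (f := fun i => t i * g i)
            (fun i _ => mul_nonneg (ht i) (by linarith [hg_lower i])) (Finset.mem_univ i₀)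
end
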